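/- arXiv:2412.02118 — 8 statements merged into one kernel-verified Lean document; each statement's English description precedes it below -/
import Mathlib

section
/- Let S be a commutative semiring, U a multiplicatively closed submonoid of S with 0 ∉ U, and T a commutative semiring which is a localization of S at U (in the sense of IsLocalization). Then: (1) if S has no zero divisors, then T has no zero divisors; (2) if S moreover is zerosumfree, then T is zerosumfree; hence the localization of an information algebra at a multiplicatively closed set not containing 0 is an information algebra. -/
/-- A localization of a zerosumfree commutative semiring is zerosumfree. -/
theorem IsLocalization.eq_zero_and_eq_zero_of_add_eq_zero
    {S T : Type*} [CommSemiring S] [CommSemiring T] (U : Submonoid S)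
    [Algebra S T] [IsLocalization U T]
    (h : ∀ a b : S, a + b = 0 → a = 0 ∧ b = 0) {a b : T} (hab : a + b = 0) :
    a = 0 ∧ b = 0 := by
  obtain ⟨x, y, d, hx, hy⟩ := IsLocalization.surj₂ U T a b
  have hxy : algebraMap S T (x + y) = 0 := by
    rw [map_add, ← hx, ← hy, ← add_mul, hab, zero_mul]
  obtain ⟨m, hm⟩ := (IsLocalization.map_eq_zero_iff U T _).1 hxy
  obtain ⟨hmx, hmy⟩ := h _ _ ((mul_add _ _ _).symm.trans hm)
  have hd := IsLocalization.map_units T d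
  exact ⟨hd.mul_left_eq_zero.1 (hx.trans ((IsLocalization.map_eq_zero_iff U T x).2 ⟨m, hmx⟩)),
    hd.mul_left_eq_zero.1 (hy.trans ((IsLocalization.map_eq_zero_iff U T y).2 ⟨m, hmy⟩))⟩

/-- The localization of a commutative semiring with no zero divisors (resp. of an information
algebra) at a multiplicatively closed set not containing `0` has no zero divisors
(resp. is an information algebra). -/
theorem localization_of_information_algebra
    (S T : Type*) [CommSemiring S] [CommSemiring T] (U : Submonoid S) (hU : (0 : S) ∉ U)
    [Algebra S T] [IsLocalization U T] :
    ((∀ a b : S, a * b = 0 → a = 0 ∨ b = 0) →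
      ∀ a b : T, a * b = 0 → a = 0 ∨ b = 0) ∧
    ((∀ a b : S, a * b = 0 → a = 0 ∨ b = 0) →
      (∀ a b : S, a + b = 0 → a = 0 ∧ b = 0) →
      ∀ a b : T, a + b = 0 → a = 0 ∧ b = 0) := by
  refine ⟨fun h a b hab ↦ ?_, fun _ h a b hab ↦
    IsLocalization.eq_zero_and_eq_zero_of_add_eq_zero U h hab⟩
  have : NoZeroDivisors S := ⟨fun {a b} ↦ h a b⟩
  have : NoZeroDivisors T := IsLocalization.noZeroDivisors U
  exact mul_eq_zero.1 hab
end

section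
/- Let k ≥ 2 be an integer and let U be a multiplicatively closed submonoid of the Indigenous semiring S_k with 0 ∉ U which contains some element a ∈ {2, ..., k}. Then any localization T of S_k at U is isomorphic to the Boolean semiring: T has exactly the two elements 0 and 1 (i.e., every x ∈ T satisfies x = 0 or x = 1, and 0 ≠ 1 in T), and 1 + 1 = 1 holds in T. -/
/-- The ring congruence on ℕ identifying all numbers greater than `k`. -/
def indCon (k : ℕ) : RingCon ℕ where
  r a b := a = b ∨ (k < a ∧ k < b)
  iseqv := by
    refine ⟨fun _ => Or.inl rfl, ?_, ?_⟩
    · rintro a b (rfl | ⟨h1, h2⟩)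
      · exact Or.inl rfl
      · exact Or.inr ⟨h2, h1⟩
    · rintro a b c (rfl | ⟨h1, h2⟩) (rfl | ⟨h3, h4⟩)
      · exact Or.inl rfl
      · exact Or.inr ⟨h3, h4⟩
      · exact Or.inr ⟨h1, h2⟩
      · exact Or.inr ⟨h1, h4⟩
  add' := by
    rintro a b c d (rfl | ⟨ha, hb⟩) (rfl | ⟨hc, hd⟩)
    · exact Or.inl rfl
    · exact Or.inr ⟨by omega, by omega⟩
    · exact Or.inr ⟨by omega, by omega⟩
    · exact Or.inr ⟨by omega, by omega⟩
  mul' := by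
    rintro a b c d (rfl | ⟨ha, hb⟩) (rfl | ⟨hc, hd⟩)
    · exact Or.inl rfl
    · rcases Nat.eq_zero_or_pos a with rfl | ha0
      · simp
      · exact Or.inr ⟨lt_of_lt_of_le hc (Nat.le_mul_of_pos_left c ha0),
          lt_of_lt_of_le hd (Nat.le_mul_of_pos_left d ha0)⟩
    · rcases Nat.eq_zero_or_pos c with rfl | hc0
      · simp
      · exact Or.inr ⟨lt_of_lt_of_le ha (Nat.le_mul_of_pos_right a hc0),
          lt_of_lt_of_le hb (Nat.le_mul_of_pos_right b hc0)⟩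
    · exact Or.inr ⟨lt_of_lt_of_le ha (Nat.le_mul_of_pos_right a (by omega)),
        lt_of_lt_of_le hb (Nat.le_mul_of_pos_right b (by omega))⟩

/-- The Indigenous semiring `S_k = {0, 1, ..., k} ∪ {m}`, realized as the quotient of ℕ
by the congruence identifying all numbers greater than `k`. -/
abbrev IndSemiring (k : ℕ) : Type := (indCon k).Quotient

/-- The element `m` ("many") of the Indigenous semiring. -/
def indM (k : ℕ) : IndSemiring k := (indCon k).mk' (k + 1)


namespace IndSemiring

theorem mk'_eq_indM {k n : ℕ} (hn : k < n) : (indCon k).mk' n = indM k :=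
  (RingCon.eq (indCon k)).mpr (Or.inr ⟨hn, k.lt_succ_self⟩)

theorem indM_mul_mk' (k : ℕ) {n : ℕ} (hn : 0 < n) : indM k * (indCon k).mk' n = indM k := by
  rw [indM, ← map_mul]
  exact mk'_eq_indM (k.lt_succ_self.trans_le (Nat.le_mul_of_pos_right _ hn))

theorem indM_mem {k : ℕ} {U : Submonoid (IndSemiring k)} {a : ℕ} (ha : 2 ≤ a)
    (haU : (indCon k).mk' a ∈ U) : indM k ∈ U := by
  rw [← mk'_eq_indM (Nat.lt_pow_self ha), map_pow]
  exact U.pow_mem haU k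

theorem algebraMap_eq_one {k : ℕ} {U : Submonoid (IndSemiring k)} (hm : indM k ∈ U)
    (T : Type*) [CommSemiring T] [Algebra (IndSemiring k) T] [IsLocalization U T]
    {x : IndSemiring k} (hx : x ≠ 0) : algebraMap (IndSemiring k) T x = 1 := by
  obtain ⟨n, rfl⟩ := (indCon k).mk'_surjective x
  have hn : 0 < n := Nat.pos_of_ne_zero fun h => hx (by rw [h, map_zero])
  apply (IsLocalization.map_units T (⟨indM k, hm⟩ : U)).mul_left_cancel
  rw [← map_mul, indM_mul_mk' k hn, mul_one]

end IndSemiring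

/-- Let `k ≥ 2` and let `U` be a multiplicatively closed submonoid of `S_k` with `0 ∉ U`
containing some `a ∈ {2, …, k}`. Then any localization `T` of `S_k` at `U` is isomorphic to
the Boolean semiring: every element of `T` is `0` or `1`, `0 ≠ 1`, and `1 + 1 = 1` in `T`. -/
theorem localization_indSemiring_is_boolean (k : ℕ) (hk : 2 ≤ k)
    (U : Submonoid (IndSemiring k)) (h0 : (0 : IndSemiring k) ∉ U)
    (ha : ∃ a : ℕ, 2 ≤ a ∧ a ≤ k ∧ (indCon k).mk' a ∈ U)
    (T : Type*) [CommSemiring T] [Algebra (IndSemiring k) T] [IsLocalization U T] :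
    (∀ x : T, x = 0 ∨ x = 1) ∧ (0 : T) ≠ 1 ∧ (1 : T) + 1 = 1 := by
  obtain ⟨a, ha2, -, haU⟩ := ha
  have hone {x : IndSemiring k} (hx : x ≠ 0) : algebraMap (IndSemiring k) T x = 1 :=
    IndSemiring.algebraMap_eq_one (IndSemiring.indM_mem ha2 haU) T hx
  refine ⟨fun z => ?_, fun h => ?_, ?_⟩
  · obtain ⟨⟨r, s⟩, hz⟩ := IsLocalization.surj U z
    rw [hone (ne_of_mem_of_not_mem s.2 h0), mul_one] at hz
    rw [hz]
    by_cases hr : r = 0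
    · exact Or.inl (by simp [hr])
    · exact Or.inr (hone hr)
  · rw [← map_zero (algebraMap (IndSemiring k) T), ← map_one (algebraMap (IndSemiring k) T)] at h
    obtain ⟨c, hc⟩ := IsLocalization.exists_of_eq (M := U) h
    rw [mul_zero, mul_one] at hc
    exact h0 (hc ▸ c.2)
  · have htwo : (indCon k).mk' 2 ≠ 0 := fun h =>
      absurd ((RingCon.eq (indCon k)).mp h) (by simp [indCon])
    have h := hone htwo
    rwa [← one_add_one_eq_two, map_add, map_add, map_one, map_one] at h
end

section
/- For any positive integer k, the subset {0, m} of the Indigenous semiring S_k is an ideal, every nonzero ideal of S_k contains the element m, and consequently {0, m} is the smallest nonzero ideal of S_k (it is contained in every nonzero ideal). -/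
theorem coe_eq_indM {k n : ℕ} (h : k < n) : (n : IndSemiring k) = indM k :=
  (RingCon.eq (indCon k)).2 (Or.inr ⟨h, k.lt_succ_self⟩)

theorem indM_add_indM (k : ℕ) : indM k + indM k = indM k :=
  coe_eq_indM (k := k) (n := (k + 1) + (k + 1)) (by omega)

theorem mul_indM {k : ℕ} {x : IndSemiring k} (hx : x ≠ 0) : x * indM k = indM k := by
  induction x using Quotient.inductionOn' with
  | h n =>
    have hn : 0 < n := Nat.pos_of_ne_zero fun h => hx (by subst h; rfl)
    exact coe_eq_indM (k := k) (n := n * (k + 1)) (Nat.le_mul_of_pos_left (k + 1) hn)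

/-- The ideal `{0, m}` of the Indigenous semiring. -/
def indIdeal (k : ℕ) : Ideal (IndSemiring k) where
  carrier := {x | x = 0 ∨ x = indM k}
  zero_mem' := Or.inl rfl
  add_mem' := by
    rintro a b (rfl | rfl) (rfl | rfl)
    · exact Or.inl (add_zero 0)
    · exact Or.inr (zero_add _)
    · exact Or.inr (add_zero _)
    · exact Or.inr (indM_add_indM k)
  smul_mem' := by
    rintro c x (rfl | rfl)
    · exact Or.inl (smul_zero c)
    · rcases eq_or_ne c 0 with rfl | hc
      · exact Or.inl (zero_mul _)
      · exact Or.inr (mul_indM hc)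

theorem indM_mem_of_ne_bot {k : ℕ} {J : Ideal (IndSemiring k)} (hJ : J ≠ ⊥) : indM k ∈ J := by
  obtain ⟨x, hxJ, hx⟩ := Submodule.exists_mem_ne_zero_of_ne_bot hJ
  exact mul_indM hx ▸ J.mul_mem_right (indM k) hxJ

/-- For any positive integer `k`, the subset `{0, m}` of `S_k` is an ideal, every nonzero
ideal of `S_k` contains `m`, and `{0, m}` is the smallest nonzero ideal of `S_k`. -/
theorem smallest_nonzero_ideal_indSemiring (k : ℕ) (hk : 0 < k) :
    ∃ I : Ideal (IndSemiring k), (∀ x : IndSemiring k, x ∈ I ↔ x = 0 ∨ x = indM k) ∧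
      ∀ J : Ideal (IndSemiring k), J ≠ ⊥ → indM k ∈ J ∧ I ≤ J := by
  refine ⟨indIdeal k, fun x => Iff.rfl, fun J hJ => ⟨indM_mem_of_ne_bot hJ, ?_⟩⟩
  rintro x (rfl | rfl)
  · exact J.zero_mem
  · exact indM_mem_of_ne_bot hJ
end

section
/- For any positive integer k, the Indigenous semiring S_k is austere: if I is an ideal of S_k that is subtractive (that is, for all a, b ∈ S_k, a ∈ I and a + b ∈ I imply b ∈ I), then I is the zero ideal or I = S_k. -/
/-- For any positive integer `k`, the Indigenous semiring `S_k` is austere: every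
subtractive ideal of `S_k` is the zero ideal or all of `S_k`. -/
theorem indSemiring_austere (k : ℕ) (hk : 0 < k) (I : Ideal (IndSemiring k))
    (hsub : ∀ a b : IndSemiring k, a ∈ I → a + b ∈ I → b ∈ I) :
    I = ⊥ ∨ I = ⊤ := by
  rw [or_iff_not_imp_left, ← ne_eq, Submodule.ne_bot_iff]
  rintro ⟨x, hxI, hx0⟩
  obtain ⟨n, rfl⟩ := (indCon k).mk'_surjective x
  have hn : 0 < n := Nat.pos_of_ne_zero fun h => hx0 (by rw [h, map_zero])
  have hm : (indCon k).mk' ((k + 1) * n) ∈ I := by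
    rw [map_mul]
    exact I.mul_mem_left _ hxI
  have hlt : k < (k + 1) * n := Nat.le_mul_of_pos_right _ hn
  have habs : (indCon k).mk' ((k + 1) * n) + 1 = (indCon k).mk' ((k + 1) * n) := by
    rw [← map_one (indCon k).mk', ← map_add]
    exact (indCon k).eq.mpr (Or.inr ⟨hlt.trans (Nat.lt_succ_self _), hlt⟩)
  exact (Ideal.eq_top_iff_one I).mpr (hsub _ 1 hm (habs.symm ▸ hm))
end

section
/- For any positive integer k, an ideal P of the Indigenous semiring S_k is prime if and only if P is the zero ideal {0} or P = S_k \ {1} = {x ∈ S_k : x ≠ 1}. -/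
theorem indCon_natCast_eq_iff {k a b : ℕ} :
    (a : IndSemiring k) = b ↔ a = b ∨ (k < a ∧ k < b) :=
  (indCon k).eq

theorem IndSemiring.exists_natCast {k : ℕ} (x : IndSemiring k) : ∃ n : ℕ, (n : IndSemiring k) = x :=
  Quotient.exists_rep x

theorem IndSemiring.natCast_eq_zero_iff {k n : ℕ} : (n : IndSemiring k) = 0 ↔ n = 0 := by
  rw [← Nat.cast_zero, indCon_natCast_eq_iff]
  omega

theorem IndSemiring.natCast_eq_one_iff {k n : ℕ} (hk : 0 < k) :
    (n : IndSemiring k) = 1 ↔ n = 1 := by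
  rw [← Nat.cast_one, indCon_natCast_eq_iff]
  omega

theorem IndSemiring.mul_eq_zero {k : ℕ} {x y : IndSemiring k} :
    x * y = 0 ↔ x = 0 ∨ y = 0 := by
  obtain ⟨a, rfl⟩ := x.exists_natCast
  obtain ⟨b, rfl⟩ := y.exists_natCast
  rw [← Nat.cast_mul, natCast_eq_zero_iff, natCast_eq_zero_iff, natCast_eq_zero_iff,
    Nat.mul_eq_zero]

theorem IndSemiring.mul_eq_one {k : ℕ} (hk : 0 < k) {x y : IndSemiring k} :
    x * y = 1 ↔ x = 1 ∧ y = 1 := by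
  obtain ⟨a, rfl⟩ := x.exists_natCast
  obtain ⟨b, rfl⟩ := y.exists_natCast
  rw [← Nat.cast_mul, natCast_eq_one_iff hk, natCast_eq_one_iff hk, natCast_eq_one_iff hk,
    _root_.mul_eq_one]

/-- A nonzero ideal contains the class of every number greater than `k`. -/
theorem IndSemiring.natCast_mem_of_lt {k n : ℕ} {P : Ideal (IndSemiring k)} (hP : P ≠ ⊥)
    (hn : k < n) : (n : IndSemiring k) ∈ P := by
  obtain ⟨x, hxP, hx⟩ := Submodule.exists_mem_ne_zero_of_ne_bot hP
  obtain ⟨a, rfl⟩ := x.exists_natCast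
  have ha : 0 < a := Nat.pos_of_ne_zero fun h => hx (natCast_eq_zero_iff.2 h)
  have h : (n : IndSemiring k) = (n * a : ℕ) :=
    indCon_natCast_eq_iff.2 (Or.inr ⟨hn, hn.trans_le (Nat.le_mul_of_pos_right n ha)⟩)
  rw [h, Nat.cast_mul]
  exact P.mul_mem_left _ hxP

/-- For any positive integer `k`, an ideal `P` of the Indigenous semiring `S_k` is prime if
and only if `P` is the zero ideal or `P = S_k \ {1}`. -/
theorem prime_ideals_indSemiring (k : ℕ) (hk : 0 < k) (P : Ideal (IndSemiring k)) :
    P.IsPrime ↔ (P = ⊥ ∨ ∀ x : IndSemiring k, x ∈ P ↔ x ≠ 1) := by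
  constructor
  · intro hP
    refine or_iff_not_imp_left.2 fun hbot x => ⟨?_, fun hx => ?_⟩
    · rintro hx rfl
      exact hP.ne_top ((Ideal.eq_top_iff_one P).2 hx)
    · obtain ⟨a, rfl⟩ := x.exists_natCast
      have ha : a ≠ 1 := fun h => hx ((IndSemiring.natCast_eq_one_iff hk).2 h)
      rcases Nat.eq_zero_or_pos a with rfl | ha0
      · simp
      · have hlt : k < a ^ k := Nat.lt_pow_self (by omega)
        refine hP.mem_of_pow_mem k ?_
        rw [← Nat.cast_pow]
        exact IndSemiring.natCast_mem_of_lt hbot hlt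
  · have h01 : (0 : IndSemiring k) ≠ 1 := by
      rw [← Nat.cast_zero, Ne, IndSemiring.natCast_eq_one_iff hk]
      exact zero_ne_one
    rintro (rfl | hP)
    · refine ⟨fun h => h01 ?_, fun {x y} hxy => ?_⟩
      · exact ((Submodule.mem_bot _).1 ((Ideal.eq_top_iff_one _).1 h)).symm
      · exact IndSemiring.mul_eq_zero.1 hxy
    · refine ⟨fun h => (hP 1).1 ((Ideal.eq_top_iff_one P).1 h) rfl, fun {x y} hxy => ?_⟩
      rw [hP, Ne, IndSemiring.mul_eq_one hk, not_and_or] at hxy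
      rwa [hP, hP]
end

section
/- For a positive integer k, the Indigenous semiring S_k has a nonzero principal prime ideal (i.e., there exists a ∈ S_k such that the ideal generated by a is nonzero and prime) if and only if k ≤ 2. -/
theorem mk_mem_span_singleton_mk_iff {k n b : ℕ} (hn : 0 < n) :
    (indCon k).mk' b ∈ Ideal.span {(indCon k).mk' n} ↔ n ∣ b ∨ k < b := by
  rw [Ideal.mem_span_singleton']
  constructor
  · rintro ⟨c, hc⟩
    obtain ⟨c, rfl⟩ := (indCon k).mk'_surjective c
    rw [← map_mul] at hc
    rcases (indCon k).eq.1 hc with h | h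
    · exact Or.inl ⟨c, by rw [← h, mul_comm]⟩
    · exact Or.inr h.2
  · rintro (⟨c, rfl⟩ | h)
    · exact ⟨(indCon k).mk' c, by rw [← map_mul, mul_comm]⟩
    · refine ⟨(indCon k).mk' (k + 1), ?_⟩
      rw [← map_mul]
      exact (indCon k).eq.2 (Or.inr ⟨by nlinarith, h⟩)

theorem mk_mem_of_isPrime_span_mk {k n b : ℕ} (hn : 0 < n) (hb : 1 < b)
    (hP : (Ideal.span {(indCon k).mk' n}).IsPrime) :
    (indCon k).mk' b ∈ Ideal.span {(indCon k).mk' n} := by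
  apply hP.mem_of_pow_mem k
  rw [← map_pow]
  exact (mk_mem_span_singleton_mk_iff hn).2 (Or.inr (Nat.lt_pow_self hb))

theorem isPrime_span_mk_two {k : ℕ} (hk : 0 < k) (hk2 : k ≤ 2) :
    (Ideal.span {(indCon k).mk' 2}).IsPrime := by
  refine ⟨?_, ?_⟩
  · rw [Ne, Ideal.eq_top_iff_one, ← map_one (indCon k).mk',
      mk_mem_span_singleton_mk_iff two_pos]
    omega
  · intro x y hxy
    obtain ⟨a, rfl⟩ := (indCon k).mk'_surjective x
    obtain ⟨b, rfl⟩ := (indCon k).mk'_surjective y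
    rw [← map_mul, mk_mem_span_singleton_mk_iff two_pos] at hxy
    rw [mk_mem_span_singleton_mk_iff two_pos, mk_mem_span_singleton_mk_iff two_pos]
    by_contra! h
    obtain rfl : a = 1 := by omega
    obtain rfl : b = 1 := by omega
    omega

/-- For a positive integer `k`, the Indigenous semiring `S_k` has a nonzero principal
prime ideal if and only if `k ≤ 2`. -/
theorem nonzero_principal_prime_iff (k : ℕ) (hk : 0 < k) :
    (∃ a : IndSemiring k, Ideal.span {a} ≠ ⊥ ∧ (Ideal.span {a}).IsPrime) ↔ k ≤ 2 := by
  constructor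
  · rintro ⟨x, hx, hP⟩
    obtain ⟨n, rfl⟩ := (indCon k).mk'_surjective x
    have hn : 0 < n := by
      rcases Nat.eq_zero_or_pos n with rfl | hn
      · simp at hx
      · exact hn
    by_contra! hk2
    have h2 := (mk_mem_span_singleton_mk_iff hn).1 (mk_mem_of_isPrime_span_mk hn one_lt_two hP)
    have h3 := (mk_mem_span_singleton_mk_iff hn).1
      (mk_mem_of_isPrime_span_mk hn (by norm_num : 1 < 3) hP)
    apply hP.one_notMem
    rw [← map_one (indCon k).mk', mk_mem_span_singleton_mk_iff hn]
    exact Or.inl ((Nat.dvd_add_right (h2.resolve_right (by omega))).1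
      (h3.resolve_right (by omega)))
  · intro hk2
    refine ⟨(indCon k).mk' 2, ?_, isPrime_span_mk_two hk hk2⟩
    rw [Ne, Ideal.span_singleton_eq_bot, ← map_zero (indCon k).mk']
    intro h
    rcases (indCon k).eq.1 h with h | h <;> omega
end

section
/- Let k and n be positive integers with 2ⁿ > k. Then for any ideals I₁, ..., Iₙ of the Indigenous semiring S_k, each nonzero and proper, the product I₁·I₂·⋯·Iₙ equals the ideal {0, m} (the ideal generated by m). In particular, the multiplicative monoid of nonzero ideals of S_k is nilpotent with absorbing element {0, m}. -/
namespace IndSemiring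

variable {k : ℕ}

theorem mk_eq_zero_iff {a : ℕ} : (indCon k).mk' a = 0 ↔ a = 0 := by
  constructor
  · intro h
    have h' : (indCon k) a 0 := (RingCon.eq _).mp (h.trans (map_zero (indCon k).mk').symm)
    rcases h' with h' | h'
    · exact h'
    · exact absurd h'.2 (Nat.not_lt_zero k)
  · rintro rfl
    exact map_zero _

theorem mk_eq_indM {a : ℕ} (ha : k < a) : (indCon k).mk' a = indM k :=
  (RingCon.eq _).mpr (Or.inr ⟨ha, Nat.lt_succ_self k⟩)

theorem indM_mul_of_ne_zero {x : IndSemiring k} (hx : x ≠ 0) : indM k * x = indM k := by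
  obtain ⟨a, rfl⟩ := (indCon k).mk'_surjective x
  have ha : 0 < a := Nat.pos_of_ne_zero fun h => hx (mk_eq_zero_iff.mpr h)
  rw [indM, ← map_mul]
  exact mk_eq_indM (lt_of_lt_of_le (Nat.lt_succ_self k) (Nat.le_mul_of_pos_right _ ha))

theorem indM_ne_zero : indM k ≠ 0 := fun h => Nat.succ_ne_zero k (mk_eq_zero_iff.mp h)

theorem indM_mem_of_ne_bot {J : Ideal (IndSemiring k)} (hJ : J ≠ ⊥) : indM k ∈ J := by
  obtain ⟨x, hx, hx0⟩ := Submodule.exists_mem_ne_zero_of_ne_bot hJ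
  exact indM_mul_of_ne_zero hx0 ▸ J.mul_mem_left (indM k) hx

theorem indM_mem_prod {ι : Type*} (s : Finset ι) (hs : s.Nonempty)
    (I : ι → Ideal (IndSemiring k)) (hI : ∀ i ∈ s, I i ≠ ⊥) : indM k ∈ ∏ i ∈ s, I i := by
  classical
  induction hs using Finset.Nonempty.cons_induction with
  | singleton a => simpa using indM_mem_of_ne_bot (hI a (by simp))
  | cons a s ha hs ih =>
    rw [Finset.prod_cons, ← indM_mul_of_ne_zero indM_ne_zero]
    exact Ideal.mul_mem_mul (indM_mem_of_ne_bot (hI a (by simp)))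
      (ih fun i hi => hI i (by simp [hi]))

/-- The ideal of `S_k` consisting of `0` and the classes of all numbers that are at least `t`. -/
def tailIdeal (k t : ℕ) : Ideal (IndSemiring k) where
  carrier := {x | ∃ a : ℕ, (a = 0 ∨ t ≤ a) ∧ (indCon k).mk' a = x}
  zero_mem' := ⟨0, Or.inl rfl, map_zero _⟩
  add_mem' := by
    rintro _ _ ⟨a, ha, rfl⟩ ⟨b, hb, rfl⟩
    exact ⟨a + b, by omega, map_add _ _ _⟩
  smul_mem' := by
    rintro c _ ⟨a, ha, rfl⟩
    obtain ⟨b, rfl⟩ := (indCon k).mk'_surjective c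
    refine ⟨b * a, ?_, map_mul _ _ _⟩
    rcases Nat.eq_zero_or_pos b with rfl | hb
    · simp
    · rcases ha with rfl | ha
      · simp
      · exact Or.inr (ha.trans (Nat.le_mul_of_pos_left a hb))

theorem tailIdeal_mul_le (s t : ℕ) :
    tailIdeal k s * tailIdeal k t ≤ tailIdeal k (s * t) := by
  rw [Ideal.mul_le]
  rintro _ ⟨a, ha, rfl⟩ _ ⟨b, hb, rfl⟩
  refine ⟨a * b, ?_, map_mul _ _ _⟩
  rcases ha with rfl | ha
  · simp
  · rcases hb with rfl | hb
    · simp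
    · exact Or.inr (Nat.mul_le_mul ha hb)

theorem le_tailIdeal_two {I : Ideal (IndSemiring k)} (hI : I ≠ ⊤) : I ≤ tailIdeal k 2 := by
  intro x hx
  obtain ⟨a, rfl⟩ := (indCon k).mk'_surjective x
  have ha : a ≠ 1 := by
    rintro rfl
    exact hI ((Ideal.eq_top_iff_one I).mpr (map_one (indCon k).mk' ▸ hx))
  exact ⟨a, by omega, rfl⟩

theorem tailIdeal_le_span_indM {t : ℕ} (ht : k < t) :
    tailIdeal k t ≤ Ideal.span {indM k} := by
  rintro _ ⟨a, rfl | ha, rfl⟩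
  · rw [map_zero]
    exact zero_mem _
  · rw [mk_eq_indM (ht.trans_le ha)]
    exact Ideal.mem_span_singleton_self _

theorem prod_le_tailIdeal {ι : Type*} (s : Finset ι) (I : ι → Ideal (IndSemiring k))
    (hI : ∀ i ∈ s, I i ≠ ⊤) : ∏ i ∈ s, I i ≤ tailIdeal k (2 ^ s.card) := by
  induction s using Finset.cons_induction with
  | empty =>
    intro x _
    obtain ⟨a, rfl⟩ := (indCon k).mk'_surjective x
    exact ⟨a, by simp; omega, rfl⟩
  | cons a s ha ih =>
    rw [Finset.prod_cons, Finset.card_cons, pow_succ']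
    exact (Ideal.mul_mono (le_tailIdeal_two (hI a (by simp)))
      (ih fun i hi => hI i (by simp [hi]))).trans (tailIdeal_mul_le _ _)

end IndSemiring

/-- Let `k` and `n` be positive integers with `2^n > k`. Then the product of any `n`
nonzero proper ideals of `S_k` equals the ideal `{0, m}` generated by `m`; in particular
the ideal generated by `m` is an absorbing element of the monoid of nonzero ideals. -/
theorem product_of_nonzero_proper_ideals (k n : ℕ) (hk : 0 < k) (hn : 0 < n)
    (h2 : k < 2 ^ n) :
    (∀ I : Fin n → Ideal (IndSemiring k), (∀ i, I i ≠ ⊥ ∧ I i ≠ ⊤) →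
      ∏ i, I i = Ideal.span {indM k}) ∧
    (∀ J : Ideal (IndSemiring k), J ≠ ⊥ →
      J * Ideal.span {indM k} = Ideal.span {indM k}) := by
  constructor
  · intro I hI
    have : NeZero n := ⟨hn.ne'⟩
    refine le_antisymm ?_ ?_
    · refine (IndSemiring.prod_le_tailIdeal _ I fun i _ => (hI i).2).trans
        (IndSemiring.tailIdeal_le_span_indM ?_)
      simpa using h2
    · rw [Ideal.span_singleton_le_iff_mem]
      exact IndSemiring.indM_mem_prod _ Finset.univ_nonempty I fun i _ => (hI i).1
  · intro J hJ
    refine le_antisymm Ideal.mul_le_right ?_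
    rw [Ideal.span_singleton_le_iff_mem]
    have h := Ideal.mul_mem_mul (IndSemiring.indM_mem_of_ne_bot hJ)
      (Ideal.mem_span_singleton_self (indM k))
    rwa [IndSemiring.indM_mul_of_ne_zero IndSemiring.indM_ne_zero] at h
end

section
/- For any positive integer k: an element x of the Indigenous semiring S_k is a unit if and only if x = 1; a polynomial p over S_k is a unit in the polynomial semiring S_k[X] if and only if p = 1; and a formal power series f over S_k is a unit in the power series semiring S_k[[X]] if and only if f = 1. -/
theorem indCon_mk_eq_mk_iff {k a b : ℕ} :
    (indCon k).mk' a = (indCon k).mk' b ↔ a = b ∨ (k < a ∧ k < b) :=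
  Quotient.eq

theorem IndSemiring.eq_one_of_isUnit {k : ℕ} (hk : 0 < k) {x : IndSemiring k}
    (hx : IsUnit x) : x = 1 := by
  obtain ⟨y, hxy⟩ := hx.exists_right_inv
  obtain ⟨a, rfl⟩ := (indCon k).mk'_surjective x
  obtain ⟨b, rfl⟩ := (indCon k).mk'_surjective y
  rw [← map_mul, ← map_one (indCon k).mk', indCon_mk_eq_mk_iff] at hxy
  have hab : a * b = 1 := by omega
  rw [Nat.eq_one_of_mul_eq_one_right hab, map_one]

theorem IndSemiring.eq_zero_of_add_eq_zero {k : ℕ} {x y : IndSemiring k}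
    (h : x + y = 0) : x = 0 := by
  obtain ⟨a, rfl⟩ := (indCon k).mk'_surjective x
  obtain ⟨b, rfl⟩ := (indCon k).mk'_surjective y
  rw [← map_add, ← map_zero (indCon k).mk', indCon_mk_eq_mk_iff] at h
  have ha : a = 0 := by omega
  rw [ha, map_zero]

/-- If a semiring is zero-sum-free and has `1` as its only unit, then so does its power series
semiring. -/
theorem PowerSeries.eq_one_of_isUnit_of_zeroSumFree {R : Type*} [CommSemiring R]
    (hunit : ∀ x : R, IsUnit x → x = 1) (hzero : ∀ x y : R, x + y = 0 → x = 0)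
    {f : PowerSeries R} (hf : IsUnit f) : f = 1 := by
  obtain ⟨g, hfg⟩ := hf.exists_right_inv
  have hg : constantCoeff g = 1 :=
    hunit _ ((IsUnit.of_mul_eq_one f (by rw [mul_comm, hfg])).map constantCoeff)
  ext n
  rcases eq_or_ne n 0 with rfl | hn
  · simpa using hunit _ (hf.map constantCoeff)
  · have hsum : ∑ p ∈ Finset.HasAntidiagonal.antidiagonal n, coeff p.1 f * coeff p.2 g = 0 := by
      rw [← coeff_mul, hfg, coeff_one, if_neg hn]
    have hmem : (n, 0) ∈ Finset.HasAntidiagonal.antidiagonal n := by simp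
    rw [← Finset.add_sum_erase _ _ hmem] at hsum
    simpa [hg, coeff_one, hn] using hzero _ _ hsum


/-- For any positive integer `k`: the only unit of `S_k` is `1`, the only unit of the
polynomial semiring `S_k[X]` is `1`, and the only unit of the power series semiring
`S_k[[X]]` is `1`. -/
theorem units_indSemiring_polynomial_powerSeries (k : ℕ) (hk : 0 < k) :
    (∀ x : IndSemiring k, IsUnit x ↔ x = 1) ∧
    (∀ p : Polynomial (IndSemiring k), IsUnit p ↔ p = 1) ∧
    (∀ f : PowerSeries (IndSemiring k), IsUnit f ↔ f = 1) := by
  have hunit : ∀ x : IndSemiring k, IsUnit x → x = 1 :=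
    fun _ => IndSemiring.eq_one_of_isUnit hk
  have hpow : ∀ f : PowerSeries (IndSemiring k), IsUnit f → f = 1 := fun _ =>
    PowerSeries.eq_one_of_isUnit_of_zeroSumFree hunit
      fun _ _ => IndSemiring.eq_zero_of_add_eq_zero
  refine ⟨fun x => ⟨hunit x, fun h => h ▸ isUnit_one⟩,
    fun p => ⟨fun h => ?_, fun h => h ▸ isUnit_one⟩, fun f => ⟨hpow f, fun h => h ▸ isUnit_one⟩⟩
  exact Polynomial.coe_eq_one_iff.mp
    (hpow _ (h.map (Polynomial.coeToPowerSeries.ringHom (R := IndSemiring k))))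
end
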